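/- Let m ≥ 6 be even and n ≥ 5 be odd, let G = C_m × C_n with vertices v_{ij} (i ∈ Z/m, j ∈ Z/n), and let M be a 3-matching of G. If there exists i such that the subgraph G' induced by the two consecutive rows R_i ∪ R_{i+1} contains exactly one edge of M and no edge of M has one end in G' and the other end in G − V(G'), then M is contained in a perfect matching of G. -/

import Mathlib

open SimpleGraph

/-- A set of edges of `G` forming a matching: pairwise disjoint edges of `G`. -/
def IsMatchingSet {V : Type*} (G : SimpleGraph V) (M : Set (Sym2 V)) : Prop :=
  M ⊆ G.edgeSet ∧ M.Pairwise fun e f => ∀ v, v ∈ e → v ∉ f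

/-- A perfect matching of `G`: a matching covering every vertex. -/
def IsPerfectMatchingSet {V : Type*} (G : SimpleGraph V) (M : Set (Sym2 V)) : Prop :=
  IsMatchingSet G M ∧ ∀ v : V, ∃ e ∈ M, v ∈ e

/-- `G` is `k`-extendable: it has a perfect matching, and every `k`-matching
extends to a perfect matching. -/
def Extendable {V : Type*} (G : SimpleGraph V) (k : ℕ) : Prop :=
  (∃ P, IsPerfectMatchingSet G P) ∧
    ∀ M : Set (Sym2 V), IsMatchingSet G M → M.ncard = k →
      ∃ P, IsPerfectMatchingSet G P ∧ M ⊆ P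

/-- The cycle graph on `n` vertices, with vertex set `ZMod n`. -/
def cycleZMod (n : ℕ) : SimpleGraph (ZMod n) :=
  SimpleGraph.fromRel fun a b => b = a + 1

/-- `σ` sends every vertex to its partner in a perfect matching of `G`. -/
def IsMate {V : Type*} (G : SimpleGraph V) (σ : V → V) : Prop :=
  ∀ v, G.Adj v (σ v) ∧ σ (σ v) = v

theorem IsMate.isPerfectMatchingSet {V : Type*} {G : SimpleGraph V} {σ : V → V}
    (h : IsMate G σ) : IsPerfectMatchingSet G (Set.range fun v => s(v, σ v)) := by
  refine ⟨⟨?_, ?_⟩, fun v => ⟨s(v, σ v), ⟨v, rfl⟩, Sym2.mem_mk_left _ _⟩⟩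
  · rintro _ ⟨v, rfl⟩
    exact (h v).1
  · rintro _ ⟨v, rfl⟩ _ ⟨w, rfl⟩ hne x hx hx'
    apply hne
    have hv := (h v).2
    have hw := (h w).2
    simp only [Sym2.mem_iff] at hx hx'
    simp only [Sym2.eq_iff]
    grind

/-- Exchanging the edges of an alternating 4-cycle. -/
theorem IsMate.exists_flip {V : Type*} {G : SimpleGraph V} {σ : V → V} (h : IsMate G σ)
    {u w : V} (hne : σ u ≠ w) (huw : G.Adj u w) (huw' : G.Adj (σ u) (σ w)) :
    ∃ σ', IsMate G σ' ∧ σ' u = w ∧ σ' (σ u) = σ w ∧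
      ∀ v, v ≠ u → v ≠ w → v ≠ σ u → v ≠ σ w → σ' v = σ v := by
  classical
  have hu := h u
  have hw := h w
  have h1 := huw.ne
  have h2 := huw'.ne
  have h3 := hu.1.ne
  have h4 := hw.1.ne
  refine ⟨fun v => if v = u then w else if v = w then u else
    if v = σ u then σ w else if v = σ w then σ u else σ v, ?_, ?_, ?_, ?_⟩
  · intro v
    have hv := h v
    have := huw.symm
    have := huw'.symm
    constructor <;> grind
  all_goals grind

theorem cycleZMod_adj_add_one {n : ℕ} (hn : 1 < n) (a : ZMod n) :
    (cycleZMod n).Adj a (a + 1) := by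
  have : Fact (1 < n) := ⟨hn⟩
  simp [cycleZMod]

theorem exists_eq_of_mem_edgeSet {m n : ℕ} {e : Sym2 (ZMod m × ZMod n)}
    (he : e ∈ (cycleZMod m □ cycleZMod n).edgeSet) :
    ∃ a c, e = s((a, c), (a, c + 1)) ∨ e = s((a, c), (a + 1, c)) := by
  induction e with | _ u w
  obtain ⟨a, c⟩ := u
  obtain ⟨b, d⟩ := w
  simp only [mem_edgeSet, boxProd_adj, cycleZMod, fromRel_adj] at he
  rcases he with ⟨⟨-, rfl | rfl⟩, rfl⟩ | ⟨⟨-, rfl | rfl⟩, rfl⟩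
  · exact ⟨a, c, .inr rfl⟩
  · exact ⟨b, c, .inr Sym2.eq_swap⟩
  · exact ⟨a, c, .inl rfl⟩
  · exact ⟨a, d, .inl Sym2.eq_swap⟩

/-- Pairs `s` with `s + 1`, `s + 2` with `s + 3`, and so on. -/
def pairing {n : ℕ} (s j : ZMod n) : ZMod n :=
  if Even (j - s).val then j + 1 else j - 1

theorem ZMod.val_add_one_of_ne {n : ℕ} (hn : 1 < n) {t : ZMod n} (ht : t + 1 ≠ 0) :
    (t + 1).val = t.val + 1 := by
  have : NeZero n := ⟨by omega⟩
  have : Fact (1 < n) := ⟨hn⟩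
  have h1 := ZMod.val_lt t
  rw [ZMod.val_add, ZMod.val_one, Nat.mod_eq_of_lt]
  by_contra h2
  apply ht
  rw [← ZMod.val_eq_zero, ZMod.val_add, ZMod.val_one, show t.val + 1 = n by omega, Nat.mod_self]

theorem ZMod.even_val_add_one {n : ℕ} (hn : 1 < n) {t : ZMod n} (h : Even n ∨ t + 1 ≠ 0) :
    Even (t + 1).val ↔ ¬ Even t.val := by
  by_cases ht : t + 1 = 0
  · have : NeZero n := ⟨by omega⟩
    obtain rfl : t = -1 := by linear_combination ht
    have : Fact (1 < n) := ⟨hn⟩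
    have hev : Even n := by tauto
    have h1 : (-1 : ZMod n).val = n - 1 := by
      rw [ZMod.neg_val, if_neg one_ne_zero, ZMod.val_one]
    rw [h1, ht, ZMod.val_zero]
    grind
  · rw [ZMod.val_add_one_of_ne hn ht]
    grind

theorem pairing_eq_or {n : ℕ} (s j : ZMod n) : pairing s j = j + 1 ∨ pairing s j = j - 1 := by
  unfold pairing
  split_ifs <;> simp

theorem pairing_pairing {n : ℕ} (hn : 1 < n) {s j : ZMod n} (h : Even n ∨ j + 1 ≠ s) :
    pairing s (pairing s j) = j := by
  unfold pairing
  by_cases hj : Even (j - s).val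
  · have := @ZMod.even_val_add_one n hn (j - s) (by grind)
    rw [show j - s + 1 = j + 1 - s by ring] at this
    grind
  · have h0 : j - s ≠ 0 := by
      intro h0
      simp [h0] at hj
    have := @ZMod.even_val_add_one n hn (j - 1 - s) (by grind)
    rw [show j - 1 - s + 1 = j - s by ring] at this
    grind

theorem ZMod.even_val_neg {n : ℕ} (hno : Odd n) {t : ZMod n} (ht : t ≠ 0) :
    Even (-t).val ↔ ¬ Even t.val := by
  have : NeZero n := ⟨hno.pos.ne'⟩
  rw [ZMod.neg_val, if_neg ht]
  have := ZMod.val_lt t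
  grind

theorem pairing_add_one_ne {n : ℕ} (hn : 1 < n) (hno : Odd n) {s j : ZMod n}
    (h : j + 1 ≠ s) : pairing s j + 1 ≠ s := by
  unfold pairing
  have : Fact (1 < n) := ⟨hn⟩
  split_ifs with hj <;> intro h2
  · have h3 := @ZMod.even_val_add_one n hn (j - s) (by grind)
    rw [show j - s + 1 = -1 by rw [← h2]; ring,
      ZMod.even_val_neg hno one_ne_zero, ZMod.val_one] at h3
    simp_all
  · apply hj
    simp [← h2]

theorem pairing_adj {n : ℕ} (hn : 1 < n) (s j : ZMod n) :
    (cycleZMod n).Adj j (pairing s j) := by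
  rcases pairing_eq_or s j with h | h <;> rw [h]
  · exact cycleZMod_adj_add_one hn j
  · simpa using (cycleZMod_adj_add_one hn (j - 1)).symm

theorem boxProd_adj_pairing_left {m n : ℕ} (hm : 1 < m) (i : ZMod m) (v : ZMod m × ZMod n) :
    (cycleZMod m □ cycleZMod n).Adj v (pairing i v.1, v.2) := by
  simp [boxProd_adj, pairing_adj hm]

theorem boxProd_adj_pairing_right {m n : ℕ} (hn : 1 < n) (s : ZMod n) (v : ZMod m × ZMod n) :
    (cycleZMod m □ cycleZMod n).Adj v (v.1, pairing s v.2) := by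
  simp [boxProd_adj, pairing_adj hn]

/-- The partner map that is vertical in the column preceding `s` and horizontal elsewhere. -/
def baseMate {m n : ℕ} (i : ZMod m) (s : ZMod n) (v : ZMod m × ZMod n) : ZMod m × ZMod n :=
  if v.2 + 1 = s then (pairing i v.1, v.2) else (v.1, pairing s v.2)

theorem isMate_baseMate {m n : ℕ} (hm : 1 < m) (hme : Even m) (hn : 1 < n) (hno : Odd n)
    (i : ZMod m) (S : ZMod m → ZMod n) (hS : ∀ a, S (pairing i a) = S a) :
    IsMate (cycleZMod m □ cycleZMod n) fun v => baseMate i (S v.1) v := by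
  rintro ⟨a, j⟩
  by_cases h : j + 1 = S a
  · have h1 : baseMate i (S a) (a, j) = (pairing i a, j) := by simp [baseMate, h]
    simp only [h1]
    refine ⟨boxProd_adj_pairing_left hm i (a, j), ?_⟩
    simp [baseMate, hS, h, pairing_pairing hm (.inl hme)]
  · have h1 : baseMate i (S a) (a, j) = (a, pairing (S a) j) := by simp [baseMate, h]
    simp only [h1]
    refine ⟨boxProd_adj_pairing_right hn _ (a, j), ?_⟩
    simp [baseMate, pairing_add_one_ne hn hno h, pairing_pairing hn (.inr h)]

theorem exists_isMate_two_columns {m n : ℕ} (hm : 6 ≤ m) (hme : Even m) (hn : 5 ≤ n)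
    (hno : Odd n) (i : ZMod m) (s₀ s : ZMod n) :
    ∃ σ, IsMate (cycleZMod m □ cycleZMod n) σ ∧
      (∀ v, v.1 = i ∨ v.1 = i + 1 → σ v = baseMate i s₀ v) ∧
      ∀ a, ¬ (a = i ∨ a = i + 1) → ∀ j, j + 1 ≠ s → σ (a, j) = (a, pairing s j) := by
  classical
  refine ⟨_, isMate_baseMate (by omega) hme (by omega) hno i
    (fun a => if a = i ∨ a = i + 1 then s₀ else s) ?_, ?_, ?_⟩
  · have hi : pairing i i = i + 1 := by simp [pairing]
    have hp (a : ZMod m) : pairing i (pairing i a) = a := pairing_pairing (by omega) (.inl hme)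
    intro a
    have := hp a
    have := hp i
    have : pairing i a = i ∨ pairing i a = i + 1 ↔ a = i ∨ a = i + 1 := by grind
    simp only [this]
  · rintro v hv
    simp [hv]
  · intro a ha j hj
    simp [ha, baseMate, hj]

/-- Exchanging two horizontal edges in adjacent rows for two vertical ones. -/
theorem IsMate.exists_flip_square {m n : ℕ} {σ : ZMod m × ZMod n → ZMod m × ZMod n}
    (h : IsMate (cycleZMod m □ cycleZMod n) σ) {a b : ZMod m} {c d : ZMod n}
    (hab : (cycleZMod m).Adj a b) (ha : σ (a, c) = (a, d)) (hb : σ (b, c) = (b, d)) :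
    ∃ σ', IsMate (cycleZMod m □ cycleZMod n) σ' ∧ σ' (a, c) = (b, c) ∧ σ' (a, d) = (b, d) ∧
      ∀ v, ¬ ((v.1 = a ∨ v.1 = b) ∧ (v.2 = c ∨ v.2 = d)) → σ' v = σ v := by
  obtain ⟨σ', h', h1, h2, h3⟩ := h.exists_flip (u := (a, c)) (w := (b, c))
    (by rw [ha]; simp [hab.ne]) (by simp [boxProd_adj, hab]) (by simp [ha, hb, boxProd_adj, hab])
  rw [ha, hb] at h2
  refine ⟨σ', h', h1, h2, fun v hv => h3 v ?_ ?_ ?_ ?_⟩ <;> grind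

theorem ZMod.natCast_ne_zero_of_lt {n k : ℕ} (hk : 0 < k) (hkn : k < n) : (k : ZMod n) ≠ 0 := by
  rw [Ne, ZMod.natCast_eq_zero_iff]
  exact Nat.not_dvd_of_pos_of_lt hk hkn

theorem small_ne_zero {n : ℕ} (hn : 5 ≤ n) :
    (1 : ZMod n) ≠ 0 ∧ (2 : ZMod n) ≠ 0 ∧ (3 : ZMod n) ≠ 0 ∧ (4 : ZMod n) ≠ 0 := by
  refine ⟨?_, ?_, ?_, ?_⟩
  · exact_mod_cast ZMod.natCast_ne_zero_of_lt (n := n) (k := 1) (by omega) (by omega)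
  · exact_mod_cast ZMod.natCast_ne_zero_of_lt (n := n) (k := 2) (by omega) (by omega)
  · exact_mod_cast ZMod.natCast_ne_zero_of_lt (n := n) (k := 3) (by omega) (by omega)
  · exact_mod_cast ZMod.natCast_ne_zero_of_lt (n := n) (k := 4) (by omega) (by omega)

theorem pairing_self {n : ℕ} (s : ZMod n) : pairing s s = s + 1 := by simp [pairing]

theorem pairing_add_odd {n k : ℕ} (hno : Odd n) (hk : Odd k) (hkn : k ≤ n) (c : ZMod n) :
    pairing (c + (k : ZMod n)) c = c + 1 := by
  rcases hkn.eq_or_lt with rfl | hkn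
  · simpa using pairing_self c
  · rw [pairing, if_pos]
    rw [sub_add_cancel_left, ZMod.even_val_neg hno (ZMod.natCast_ne_zero_of_lt hk.pos hkn),
      ZMod.val_natCast_of_lt hkn]
    grind

theorem pairing_add_three {n : ℕ} (hn : 5 ≤ n) (hno : Odd n) (c : ZMod n) :
    pairing (c + 3) c = c + 1 :=
  pairing_add_odd hno (by decide : Odd 3) (by omega) c

theorem pairing_add_five {n : ℕ} (hn : 5 ≤ n) (hno : Odd n) (c : ZMod n) :
    pairing (c + 5) c = c + 1 :=
  pairing_add_odd hno (by decide : Odd 5) hn c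

theorem exists_pairing_two_edges {n : ℕ} (hn : 5 ≤ n) (hno : Odd n) (c d : ZMod n)
    (hcd : c ≠ d + 1) (hdc : d ≠ c + 1) :
    ∃ s, c + 1 ≠ s ∧ d + 1 ≠ s ∧ pairing s c = c + 1 ∧ pairing s d = d + 1 := by
  have h1 := (small_ne_zero hn).1
  by_cases h : Even (d - c).val
  · refine ⟨c, by simpa using h1, hcd.symm, pairing_self c, ?_⟩
    rw [pairing, if_pos h]
  · have h0 : d - c ≠ 0 := by
      intro h0
      simp [h0] at h
    have h2 := ZMod.even_val_neg hno h0
    rw [neg_sub] at h2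
    refine ⟨d, hdc.symm, by simpa using h1, ?_, pairing_self d⟩
    rw [pairing, if_pos (h2.2 h)]

theorem exists_pairing_edge_vertex {n : ℕ} (hn : 5 ≤ n) (hno : Odd n) (c d : ZMod n) :
    ∃ s, c + 1 ≠ s ∧ d + 1 ≠ s ∧ pairing s c = c + 1 := by
  obtain ⟨h1, h2, h3, -⟩ := small_ne_zero hn
  by_cases h : d + 1 = c
  · exact ⟨c + 3, fun h' => h2 (by linear_combination -h'),
      fun h' => h3 (by linear_combination h - h'), pairing_add_three hn hno c⟩
  · exact ⟨c, by simpa using h1, h, pairing_self c⟩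

theorem exists_pairing_two_vertices {n : ℕ} (hn : 5 ≤ n) (hno : Odd n) (c d : ZMod n) :
    ∃ s, c + 1 ≠ s ∧ d + 1 ≠ s ∧ pairing s c ≠ d := by
  obtain ⟨h1, h2, h3, -⟩ := small_ne_zero hn
  by_cases h : d = c + 1
  · subst h
    have hc : c + 1 ≠ c + 4 := fun h' => h3 (by linear_combination -h')
    refine ⟨c + 4, hc, fun h' => h2 (by linear_combination -h'), fun h' => h2 ?_⟩
    have h5 := pairing_pairing (n := n) (by omega) (.inr hc)
    have h6 := pairing_add_three hn hno (c + 1)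
    rw [show c + 1 + 3 = c + 4 by ring, ← h', h5] at h6
    linear_combination -h6 - h'
  · by_cases h' : d = c + 2
    · subst h'
      refine ⟨c + 2, fun h' => h1 (by linear_combination -h'),
        fun h' => h1 (by linear_combination h'), fun h' => ?_⟩
      rcases pairing_eq_or (c + 2) c with h'' | h''
      · exact h1 (by linear_combination h'' - h')
      · exact h3 (by linear_combination h'' - h')
    · refine ⟨c + 3, fun h'' => h2 (by linear_combination -h''),
        fun h'' => h' (by linear_combination h''), ?_⟩
      rw [pairing_add_three hn hno c]
      exact Ne.symm h

theorem exists_adj_row {m : ℕ} (hm : 6 ≤ m) {i a b : ZMod m}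
    (ha : ¬ (a = i ∨ a = i + 1)) (hb : ¬ (b = i ∨ b = i + 1)) :
    (∃ z, (cycleZMod m).Adj b z ∧ z ≠ a ∧ ¬ (z = i ∨ z = i + 1)) ∨
      ∃ z, (cycleZMod m).Adj a z ∧ z ≠ b ∧ ¬ (z = i ∨ z = i + 1) := by
  have hadj (x : ZMod m) := cycleZMod_adj_add_one (show 1 < m by omega) x
  have hadj' (x : ZMod m) : (cycleZMod m).Adj x (x - 1) := by simpa using (hadj (x - 1)).symm
  by_contra! hcon
  have hb1 := or_iff_not_imp_left.2 (hcon.1 _ (hadj b))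
  have hb2 := or_iff_not_imp_left.2 (hcon.1 _ (hadj' b))
  have ha1 := or_iff_not_imp_left.2 (hcon.2 _ (hadj a))
  have ha2 := or_iff_not_imp_left.2 (hcon.2 _ (hadj' a))
  obtain ⟨h1, h2, h3, h4⟩ : (1 : ZMod m) ≠ 0 ∧ (1 : ZMod m) + 1 ≠ 0 ∧ (1 : ZMod m) + 1 + 1 ≠ 0 ∧
      (1 : ZMod m) + 1 + 1 + 1 ≠ 0 := by
    norm_num [small_ne_zero (show 5 ≤ m by omega)]
  clear hcon hadj hadj'
  generalize (1 : ZMod m) = u at *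
  grind

theorem exists_isMate_shifted {m n : ℕ} (hm : 6 ≤ m) (hme : Even m) (hn : 5 ≤ n)
    (hno : Odd n) (i : ZMod m) (s₀ : ZMod n) {y z : ZMod m} (hyz : (cycleZMod m).Adj y z)
    (hy : ¬ (y = i ∨ y = i + 1)) (hz : ¬ (z = i ∨ z = i + 1)) (c : ZMod n) :
    ∃ σ, IsMate (cycleZMod m □ cycleZMod n) σ ∧
      (∀ v, v.1 = i ∨ v.1 = i + 1 → σ v = baseMate i s₀ v) ∧ σ (y, c) = (y, c + 1) ∧
      ∀ a, ¬ (a = i ∨ a = i + 1) → a ≠ y → a ≠ z →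
        σ (a, c - 1) = (a, c) ∧ σ (a, c + 1) = (a, c + 2) := by
  obtain ⟨h1, h2, h3, h4⟩ := small_ne_zero hn
  have hp1 : pairing (c + 4) (c - 1) = c := by
    have := pairing_add_five hn hno (c - 1)
    rwa [show c - 1 + 5 = c + 4 by ring, sub_add_cancel] at this
  have hp2 : pairing (c + 4) (c + 1) = c + 2 := by
    have := pairing_add_three hn hno (c + 1)
    rwa [show c + 1 + 3 = c + 4 by ring, show c + 1 + 1 = c + 2 by ring] at this
  obtain ⟨σ, hσ, hin, hout⟩ := exists_isMate_two_columns hm hme hn hno i s₀ (c + 4)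
  have hl (a) (ha : ¬ (a = i ∨ a = i + 1)) : σ (a, c - 1) = (a, c) := by
    rw [hout a ha _ fun h => h4 (by linear_combination -h), hp1]
  have hr (a) (ha : ¬ (a = i ∨ a = i + 1)) : σ (a, c + 1) = (a, c + 2) := by
    rw [hout a ha _ fun h => h2 (by linear_combination -h), hp2]
  have d1 : c + 1 ≠ c - 1 := fun h => h2 (by linear_combination h)
  have d2 : c + 1 ≠ c := by simpa using h1
  have d3 : c ≠ c + 2 := fun h => h2 (by linear_combination -h)
  obtain ⟨σ₁, hσ₁, -, h₁c, h₁⟩ := hσ.exists_flip_square hyz (hl y hy) (hl z hz)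
  obtain ⟨σ₂, hσ₂, h₂c, -, h₂⟩ := hσ₁.exists_flip_square hyz
    (c := c + 1) (d := c + 2) (by rw [h₁ _ (by grind), hr y hy]) (by rw [h₁ _ (by grind), hr z hz])
  have hyc : σ₂ (y, c) = (z, c) := by rw [h₂ _ (by grind), h₁c]
  obtain ⟨σ₃, hσ₃, h₃c, -, h₃⟩ := hσ₂.exists_flip (u := (y, c)) (w := (y, c + 1))
    (by grind) (by simpa [boxProd_adj] using cycleZMod_adj_add_one (by omega) c)
    (by simpa [hyc, h₂c, boxProd_adj] using cycleZMod_adj_add_one (by omega) c)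
  have hrest (v : ZMod m × ZMod n) (hvy : v.1 ≠ y) (hvz : v.1 ≠ z) : σ₃ v = σ v := by
    rw [h₃ v (by grind) (by grind) (by grind) (by grind), h₂ v (by grind), h₁ v (by grind)]
  refine ⟨σ₃, hσ₃, fun v hv => ?_, h₃c, fun a ha hay haz => ⟨?_, ?_⟩⟩
  · rw [hrest v (by grind) (by grind), hin v hv]
  · rw [hrest _ hay haz, hl a ha]
  · rw [hrest _ hay haz, hr a ha]

theorem exists_isMate_overlapping {m n : ℕ} (hm : 6 ≤ m) (hme : Even m) (hn : 5 ≤ n)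
    (hno : Odd n) (i : ZMod m) (s₀ : ZMod n) {a b : ZMod m} (hab : a ≠ b)
    (ha : ¬ (a = i ∨ a = i + 1)) (hb : ¬ (b = i ∨ b = i + 1)) (c : ZMod n) :
    ∃ σ, IsMate (cycleZMod m □ cycleZMod n) σ ∧
      (∀ v, v.1 = i ∨ v.1 = i + 1 → σ v = baseMate i s₀ v) ∧
      σ (a, c) = (a, c + 1) ∧ σ (b, c + 1) = (b, c + 1 + 1) := by
  rcases exists_adj_row hm ha hb with ⟨z, hz, hne, hout⟩ | ⟨z, hz, hne, hout⟩
  · obtain ⟨σ, hσ, hin, h, h'⟩ :=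
      exists_isMate_shifted hm hme hn hno i s₀ hz hb hout (c + 1)
    have := (h' a ha hab hne.symm).1
    rw [add_sub_cancel_right] at this
    exact ⟨σ, hσ, hin, this, h⟩
  · obtain ⟨σ, hσ, hin, h, h'⟩ := exists_isMate_shifted hm hme hn hno i s₀ hz ha hout c
    have := (h' b hb hab.symm hne.symm).2
    rw [show c + 2 = c + 1 + 1 by ring] at this
    exact ⟨σ, hσ, hin, h, this⟩

theorem exists_isMate_horizontal_horizontal {m n : ℕ} (hm : 6 ≤ m) (hme : Even m) (hn : 5 ≤ n)
    (hno : Odd n) (i : ZMod m) (s₀ : ZMod n) {a b : ZMod m} {c d : ZMod n}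
    (ha : ¬ (a = i ∨ a = i + 1)) (hb : ¬ (b = i ∨ b = i + 1))
    (hcd : c = d + 1 → a ≠ b) (hdc : d = c + 1 → a ≠ b) :
    ∃ σ, IsMate (cycleZMod m □ cycleZMod n) σ ∧
      (∀ v, v.1 = i ∨ v.1 = i + 1 → σ v = baseMate i s₀ v) ∧
      σ (a, c) = (a, c + 1) ∧ σ (b, d) = (b, d + 1) := by
  by_cases h : c = d + 1
  · obtain ⟨σ, hσ, hin, h1, h2⟩ :=
      exists_isMate_overlapping hm hme hn hno i s₀ (hcd h).symm hb ha d
    exact ⟨σ, hσ, hin, h ▸ h2, h1⟩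
  by_cases h' : d = c + 1
  · subst h'
    exact exists_isMate_overlapping hm hme hn hno i s₀ (hdc rfl) ha hb c
  obtain ⟨s, hs1, hs2, hs3, hs4⟩ := exists_pairing_two_edges hn hno c d h h'
  obtain ⟨σ, hσ, hin, hout⟩ := exists_isMate_two_columns hm hme hn hno i s₀ s
  exact ⟨σ, hσ, hin, by rw [hout a ha c hs1, hs3], by rw [hout b hb d hs2, hs4]⟩

theorem exists_isMate_horizontal_vertical {m n : ℕ} (hm : 6 ≤ m) (hme : Even m) (hn : 5 ≤ n)
    (hno : Odd n) (i : ZMod m) (s₀ : ZMod n) {a b : ZMod m} {c d : ZMod n}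
    (ha : ¬ (a = i ∨ a = i + 1)) (hb : ¬ (b = i ∨ b = i + 1))
    (hb' : ¬ (b + 1 = i ∨ b + 1 = i + 1))
    (hdisj : a = b ∨ a = b + 1 → d ≠ c ∧ d ≠ c + 1) :
    ∃ σ, IsMate (cycleZMod m □ cycleZMod n) σ ∧
      (∀ v, v.1 = i ∨ v.1 = i + 1 → σ v = baseMate i s₀ v) ∧
      σ (a, c) = (a, c + 1) ∧ σ (b, d) = (b + 1, d) := by
  obtain ⟨s, hs1, hs2, hs3⟩ := exists_pairing_edge_vertex hn hno c d
  obtain ⟨σ, hσ, hin, hout⟩ := exists_isMate_two_columns hm hme hn hno i s₀ s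
  obtain ⟨σ', hσ', h1, -, h2⟩ := hσ.exists_flip_square
    (cycleZMod_adj_add_one (by omega) b) (hout b hb d hs2) (hout _ hb' d hs2)
  have hd : pairing s (pairing s d) = d := pairing_pairing (by omega) (.inr hs2)
  refine ⟨σ', hσ', fun v hv => ?_, ?_, h1⟩
  · rw [h2 v (by grind), hin v hv]
  · rw [h2 _ (by grind), hout a ha c hs1, hs3]

theorem exists_isMate_vertical_vertical {m n : ℕ} (hm : 6 ≤ m) (hme : Even m) (hn : 5 ≤ n)
    (hno : Odd n) (i : ZMod m) (s₀ : ZMod n) {a b : ZMod m} {c d : ZMod n}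
    (ha : ¬ (a = i ∨ a = i + 1)) (ha' : ¬ (a + 1 = i ∨ a + 1 = i + 1))
    (hb : ¬ (b = i ∨ b = i + 1)) (hb' : ¬ (b + 1 = i ∨ b + 1 = i + 1))
    (hdisj : c = d → a ≠ b ∧ a ≠ b + 1 ∧ a + 1 ≠ b) :
    ∃ σ, IsMate (cycleZMod m □ cycleZMod n) σ ∧
      (∀ v, v.1 = i ∨ v.1 = i + 1 → σ v = baseMate i s₀ v) ∧
      σ (a, c) = (a + 1, c) ∧ σ (b, d) = (b + 1, d) := by
  obtain ⟨s, hs1, hs2, hs3⟩ := exists_pairing_two_vertices hn hno c d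
  obtain ⟨σ, hσ, hin, hout⟩ := exists_isMate_two_columns hm hme hn hno i s₀ s
  have hc : pairing s (pairing s c) = c := pairing_pairing (by omega) (.inr hs1)
  have hd : pairing s (pairing s d) = d := pairing_pairing (by omega) (.inr hs2)
  have hab : a + 1 = b + 1 ↔ a = b := add_left_inj 1
  obtain ⟨σ₁, hσ₁, h1, -, h₁⟩ := hσ.exists_flip_square
    (cycleZMod_adj_add_one (by omega) a) (hout a ha c hs1) (hout _ ha' c hs1)
  obtain ⟨σ₂, hσ₂, h2, -, h₂⟩ := hσ₁.exists_flip_square (c := d) (d := pairing s d)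
    (cycleZMod_adj_add_one (by omega) b)
    (by rw [h₁ _ (by grind), hout b hb d hs2]) (by rw [h₁ _ (by grind), hout _ hb' d hs2])
  refine ⟨σ₂, hσ₂, fun v hv => ?_, ?_, h2⟩
  · rw [h₂ v (by grind), h₁ v (by grind), hin v hv]
  · rw [h₂ _ (by grind), h1]

/-- Any two disjoint edges avoiding rows `i` and `i + 1` lie in a perfect matching that is
the one of `baseMate i s₀` on these two rows. -/
theorem exists_isMate_of_disjoint {m n : ℕ} (hm : 6 ≤ m) (hme : Even m) (hn : 5 ≤ n)
    (hno : Odd n) (i : ZMod m) (s₀ : ZMod n) {e f : Sym2 (ZMod m × ZMod n)}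
    (he : e ∈ (cycleZMod m □ cycleZMod n).edgeSet) (hf : f ∈ (cycleZMod m □ cycleZMod n).edgeSet)
    (hei : ∀ v ∈ e, ¬ (v.1 = i ∨ v.1 = i + 1)) (hfi : ∀ v ∈ f, ¬ (v.1 = i ∨ v.1 = i + 1))
    (hef : ∀ v, v ∈ e → v ∉ f) :
    ∃ σ, IsMate (cycleZMod m □ cycleZMod n) σ ∧
      (∀ v, v.1 = i ∨ v.1 = i + 1 → σ v = baseMate i s₀ v) ∧
      (∃ v, s(v, σ v) = e) ∧ ∃ v, s(v, σ v) = f := by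
  obtain ⟨a, c, rfl | rfl⟩ := exists_eq_of_mem_edgeSet he <;>
    obtain ⟨b, d, rfl | rfl⟩ := exists_eq_of_mem_edgeSet hf <;>
    simp only [Sym2.mem_iff, forall_eq_or_imp, forall_eq] at hei hfi hef <;>
    simp only [Prod.mk.injEq] at hef
  · obtain ⟨σ, hσ, hin, h1, h2⟩ := exists_isMate_horizontal_horizontal hm hme hn hno i s₀
      (c := c) (d := d) hei.1 hfi.1 (by grind) (by grind)
    exact ⟨σ, hσ, hin, ⟨_, by rw [h1]⟩, ⟨_, by rw [h2]⟩⟩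
  · obtain ⟨σ, hσ, hin, h1, h2⟩ := exists_isMate_horizontal_vertical hm hme hn hno i s₀
      (c := c) (d := d) hei.1 hfi.1 hfi.2 (by grind)
    exact ⟨σ, hσ, hin, ⟨_, by rw [h1]⟩, ⟨_, by rw [h2]⟩⟩
  · obtain ⟨σ, hσ, hin, h1, h2⟩ := exists_isMate_horizontal_vertical hm hme hn hno i s₀
      (c := d) (d := c) hfi.1 hei.1 hei.2 (by grind)
    exact ⟨σ, hσ, hin, ⟨_, by rw [h2]⟩, ⟨_, by rw [h1]⟩⟩
  · obtain ⟨σ, hσ, hin, h1, h2⟩ := exists_isMate_vertical_vertical hm hme hn hno i s₀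
      (c := c) (d := d) hei.1 hei.2 hfi.1 hfi.2 (by grind)
    exact ⟨σ, hσ, hin, ⟨_, by rw [h1]⟩, ⟨_, by rw [h2]⟩⟩

theorem exists_baseMate_eq {m n : ℕ} (hm : 6 ≤ m) (hn : 5 ≤ n) {i : ZMod m}
    {e : Sym2 (ZMod m × ZMod n)} (he : e ∈ (cycleZMod m □ cycleZMod n).edgeSet)
    (hei : ∀ v ∈ e, v.1 = i ∨ v.1 = i + 1) :
    ∃ s₀ v, (v.1 = i ∨ v.1 = i + 1) ∧ s(v, baseMate i s₀ v) = e := by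
  obtain ⟨h1, h2, -⟩ := small_ne_zero (show 5 ≤ m by omega)
  have h1' := (small_ne_zero hn).1
  obtain ⟨a, c, rfl | rfl⟩ := exists_eq_of_mem_edgeSet he <;>
    simp only [Sym2.mem_iff, forall_eq_or_imp, forall_eq] at hei
  · refine ⟨c, (a, c), hei.1, ?_⟩
    simp [baseMate, h1', pairing_self]
  · obtain rfl : a = i := by
      rcases hei.1 with h | h
      · exact h
      · rcases hei.2 with h' | h'
        · exact absurd (by linear_combination h' - h) h2
        · exact add_right_cancel h'
    refine ⟨c + 1, (a, c), hei.1, ?_⟩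
    simp [baseMate, pairing_self]

/-- rows separator lemma for `C_m × C_n` (`m ≥ 6` even, `n ≥ 5` odd).
If for some row index `i` the induced subgraph on rows `i` and `i+1` contains exactly
one edge of the 3-matching `M`, and no edge of `M` crosses between these two rows and
the rest of the graph, then `M` extends to a perfect matching. -/
theorem cycle_boxProd_cycle_row_separator (m n : ℕ) (hm : 6 ≤ m) (hme : Even m)
    (hn : 5 ≤ n) (hno : Odd n)
    (M : Set (Sym2 (ZMod m × ZMod n)))
    (hM : IsMatchingSet (cycleZMod m □ cycleZMod n) M) (hM3 : M.ncard = 3)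
    (i : ZMod m)
    (hone : {e ∈ M | ∀ v ∈ e, v.1 = i ∨ v.1 = i + 1}.ncard = 1)
    (hsep : ∀ e ∈ M, (∀ v ∈ e, v.1 = i ∨ v.1 = i + 1) ∨ (∀ v ∈ e, ¬(v.1 = i ∨ v.1 = i + 1))) :
    ∃ P, IsPerfectMatchingSet (cycleZMod m □ cycleZMod n) P ∧ M ⊆ P := by
  obtain ⟨g, hg⟩ := Set.ncard_eq_one.1 hone
  have hgM : g ∈ M ∧ ∀ v ∈ g, v.1 = i ∨ v.1 = i + 1 := by
    have : g ∈ ({g} : Set _) := rfl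
    rwa [← hg] at this
  have hfin : M.Finite := Set.finite_of_ncard_ne_zero (by omega)
  have hcard : (M \ {g}).ncard = 2 := by
    rw [Set.ncard_sdiff_singleton_of_mem hgM.1, hM3]
  obtain ⟨e, f, hef, hM2⟩ := Set.ncard_eq_two.1 hcard
  have hout : ∀ x ∈ M \ {g}, x ∈ M ∧ ∀ v ∈ x, ¬ (v.1 = i ∨ v.1 = i + 1) := by
    rintro x ⟨hx, hxg⟩
    refine ⟨hx, (hsep x hx).resolve_left fun h => hxg ?_⟩
    rw [← hg]
    exact ⟨hx, h⟩
  obtain ⟨heM, hei⟩ := hout e (by simp [hM2])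
  obtain ⟨hfM, hfi⟩ := hout f (by simp [hM2])
  obtain ⟨s₀, v, hv, hvg⟩ := exists_baseMate_eq hm hn (hM.1 hgM.1) hgM.2
  obtain ⟨σ, hσ, hin, he, hf⟩ := exists_isMate_of_disjoint hm hme hn hno i s₀
    (hM.1 heM) (hM.1 hfM) hei hfi (hM.2 heM hfM hef)
  refine ⟨_, hσ.isPerfectMatchingSet, fun x hx => ?_⟩
  by_cases hxg : x = g
  · exact ⟨v, by simp only [hin v hv, hvg, hxg]⟩
  · have : x ∈ M \ {g} := ⟨hx, hxg⟩
    rw [hM2] at this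
    rcases this with rfl | rfl
    · exact he
    · exact hf
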